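/- arXiv:math/0210400 — 2 statements merged into one kernel-verified Lean document; each statement's English description precedes it below -/
import Mathlib

section
/- Let R be a commutative ring, I an ideal with I^2 = 0, and let B0 be an étale R/I-algebra (of finite presentation, flat, formally unramified and formally smooth). Then there exists an étale R-algebra B together with an R/I-algebra isomorphism B/IB ≅ B0, and B is unique up to R-algebra isomorphism compatible with these identifications. -/
namespace Algebra

section Uniqueness

variable {R B B' C : Type*} [CommRing R] [CommRing B] [Algebra R B] [CommRing B'] [Algebra R B']
  [CommRing C] [Algebra R C]

/-- Formally étale algebras with isomorphic reductions along surjections with nilpotent kernels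
are isomorphic, compatibly with the reductions. -/
theorem FormallyEtale.exists_algEquiv_of_surjective [FormallyEtale R B] [FormallyEtale R B']
    (f : B →ₐ[R] C) (f' : B' →ₐ[R] C) (hf : Function.Surjective f) (hf' : Function.Surjective f')
    (hk : IsNilpotent (RingHom.ker (f : B →+* C)))
    (hk' : IsNilpotent (RingHom.ker (f' : B' →+* C))) :
    ∃ φ : B ≃ₐ[R] B', ∀ b, f' (φ b) = f b := by
  let g := FormallySmooth.liftOfSurjective f f' hf' hk'
  let g' := FormallySmooth.liftOfSurjective f' f hf hk
  have hg (b : B) : f' (g b) = f b := FormallySmooth.liftOfSurjective_apply f f' hf' hk' b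
  have hg' (b : B') : f (g' b) = f' b := FormallySmooth.liftOfSurjective_apply f' f hf hk b
  refine ⟨AlgEquiv.ofAlgHom g g' ?_ ?_, hg⟩
  · exact FormallyUnramified.ext' (f' : B' →+* C) hk' _ _ fun x ↦ by simp [hg, hg']
  · exact FormallyUnramified.ext' (f : B →+* C) hk _ _ fun x ↦ by simp [hg, hg']

end Uniqueness

section Existence

variable {R : Type*} [CommRing R] {I : Ideal R} {S ι σ : Type*} [CommRing S] [Algebra R S]
  [Algebra (R ⧸ I) S] [IsScalarTower R (R ⧸ I) S]

instance SubmersivePresentation.hasCoeffs_of_quotient [Finite σ]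
    (P : SubmersivePresentation (R ⧸ I) S ι σ) : P.HasCoeffs R :=
  ⟨fun x _ ↦ Ideal.Quotient.mk_surjective x⟩

/-- The lift of a presentation over `R ⧸ I` to `R` reduces to the original algebra. -/
noncomputable def Presentation.quotientModelEquiv (P : Presentation (R ⧸ I) S ι σ)
    [P.HasCoeffs R] :
    (P.ModelOfHasCoeffs R ⧸ I.map (algebraMap R (P.ModelOfHasCoeffs R))) ≃ₐ[R] S :=
  ((TensorProduct.quotIdealMapEquivQuotTensor (P.ModelOfHasCoeffs R) I).restrictScalars R).trans
    ((P.tensorModelOfHasCoeffsEquiv R).restrictScalars R)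

@[simp]
lemma Presentation.quotientModelEquiv_mk (P : Presentation (R ⧸ I) S ι σ) [P.HasCoeffs R]
    (x : MvPolynomial ι R) :
    P.quotientModelEquiv (Ideal.Quotient.mk _ (Ideal.Quotient.mk _ x)) =
      MvPolynomial.aeval P.val x := by
  simp [quotientModelEquiv]

/-- A submersive presentation over `R ⧸ I` lifts to `R` when `I` is nilpotent. -/
noncomputable def SubmersivePresentation.liftOfIsNilpotent [Finite σ] (hI : IsNilpotent I)
    (P : SubmersivePresentation (R ⧸ I) S ι σ) :
    SubmersivePresentation R (P.ModelOfHasCoeffs R) ι σ where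
  __ := P.toPreSubmersivePresentation.ofHasCoeffs R
  jacobian_isUnit := by
    classical
    let : Fintype σ := Fintype.ofFinite _
    have hJ : (P.toPreSubmersivePresentation.ofHasCoeffs R).jacobian =
        Ideal.Quotient.mk _ (P.jacobianOfHasCoeffs R) := by
      rw [PreSubmersivePresentation.jacobian_eq_jacobiMatrix_det]
      simp only [jacobianOfHasCoeffs]
      convert! rfl
    have hnil : IsNilpotent (I.map (algebraMap R (P.ModelOfHasCoeffs R))) :=
      hI.map (Ideal.mapHom (algebraMap R (P.ModelOfHasCoeffs R)))
    rw [hJ, ← IsNilpotent.isUnit_quotient_mk_iff hnil,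
      ← MulEquiv.isUnit_map P.quotientModelEquiv]
    simpa using P.jacobian_isUnit

end Existence

universe u

/-- Étale algebras lift along quotients by nilpotent ideals. -/
theorem Etale.exists_lift_of_isNilpotent {R : Type u} [CommRing R] {I : Ideal R}
    (hI : IsNilpotent I) (S : Type*) [CommRing S] [Algebra R S] [Algebra (R ⧸ I) S]
    [IsScalarTower R (R ⧸ I) S] [Etale (R ⧸ I) S] :
    ∃ (B : Type u) (_ : CommRing B) (_ : Algebra R B),
      Etale R B ∧ Nonempty ((B ⧸ I.map (algebraMap R B)) ≃ₐ[R] S) := by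
  obtain ⟨ι, σ, _, _, P, hP⟩ :=
    (Etale.iff_isStandardSmoothOfRelativeDimension_zero (R := R ⧸ I) (S := S)).mp inferInstance
  have := (P.liftOfIsNilpotent hI).isStandardSmoothOfRelativeDimension hP
  exact ⟨P.ModelOfHasCoeffs R, inferInstance, inferInstance, inferInstance,
    ⟨P.quotientModelEquiv⟩⟩

end Algebra


/-- Infinitesimal lifting of étale algebras along a square-zero extension:
existence and uniqueness. -/
theorem etale_lift_square_zero (R : Type) [CommRing R] (I : Ideal R) (hI : I ^ 2 = ⊥)
    (B0 : Type) [CommRing B0] [Algebra R B0] [Algebra (R ⧸ I) B0]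
    [IsScalarTower R (R ⧸ I) B0] [Algebra.Etale (R ⧸ I) B0] [Module.Flat (R ⧸ I) B0] :
    (∃ (B : Type) (_ : CommRing B) (_ : Algebra R B),
        Algebra.Etale R B ∧ Module.Flat R B ∧
        Nonempty ((B ⧸ (I.map (algebraMap R B))) ≃ₐ[R] B0)) ∧
    (∀ (B B' : Type) [CommRing B] [Algebra R B] [CommRing B'] [Algebra R B'],
        Algebra.Etale R B → Algebra.Etale R B' →
        ∀ (e : (B ⧸ (I.map (algebraMap R B))) ≃ₐ[R] B0)
          (e' : (B' ⧸ (I.map (algebraMap R B'))) ≃ₐ[R] B0),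
        ∃ φ : B ≃ₐ[R] B',
          ∀ b : B, e (Ideal.Quotient.mk _ b) = e' (Ideal.Quotient.mk _ (φ b))) := by
  have hnil : IsNilpotent I := ⟨2, hI⟩
  refine ⟨?_, fun B B' _ _ _ _ _ _ e e' ↦ ?_⟩
  · obtain ⟨B, _, _, _, e⟩ := Algebra.Etale.exists_lift_of_isNilpotent hnil B0
    exact ⟨B, _, _, inferInstance, inferInstance, e⟩
  · have hker (A : Type) [CommRing A] [Algebra R A]
        (e : (A ⧸ I.map (algebraMap R A)) ≃ₐ[R] B0) :
        IsNilpotent (RingHom.ker ((e.toAlgHom.comp (Ideal.Quotient.mkₐ R _) :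
          A →ₐ[R] B0) : A →+* B0)) := by
      convert! hnil.map (Ideal.mapHom (algebraMap R A)) using 1
      ext x
      simp [RingHom.mem_ker, Ideal.Quotient.eq_zero_iff_mem]
    obtain ⟨φ, hφ⟩ := Algebra.FormallyEtale.exists_algEquiv_of_surjective
      (e.toAlgHom.comp (Ideal.Quotient.mkₐ R _)) (e'.toAlgHom.comp (Ideal.Quotient.mkₐ R _))
      (e.surjective.comp Ideal.Quotient.mk_surjective)
      (e'.surjective.comp Ideal.Quotient.mk_surjective) (hker B e) (hker B' e')
    exact ⟨φ, fun b ↦ (hφ b).symm⟩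
end

section
/- Let R be an integrally closed domain with fraction field K and let A be a finite étale R-algebra. Then A is integrally closed in A ⊗_R K; in particular, A equals the integral closure of R in A ⊗_R K. -/
open TensorProduct

/-- A finite flat module over a domain is finitely presented. -/
theorem Module.FinitePresentation.of_finite_of_flat_of_isDomain
    (R M : Type*) [CommRing R] [IsDomain R] [AddCommGroup M] [Module R M]
    [Module.Finite R M] [Module.Flat R M] : Module.FinitePresentation R M := by
  have rank_eq (p q : PrimeSpectrum R) :
      Module.rankAtStalk M p = Module.rankAtStalk M q :=
    (Module.rankAtStalk_eq_of_le_of_finite_of_flat M (bot_le (a := p))).symm.trans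
      (Module.rankAtStalk_eq_of_le_of_finite_of_flat M bot_le)
  refine Module.FinitePresentation.of_localizationSpan
    {a : R | Module.Free (Localization.Away a) (LocalizedModule.Away a M)} ?_ ?_
  · by_contra h
    obtain ⟨m, hm, hle⟩ := Ideal.exists_le_maximal _ h
    obtain ⟨a, ham, ha⟩ := Module.Free.away_of_finite_of_flat_of_rankAtStalk_constant M m
      fun _ _ ↦ rank_eq _ _
    exact ham (hle (Ideal.subset_span ha))
  · rintro ⟨a, ha⟩
    have : Module.Free (Localization.Away a) (LocalizedModule.Away a M) := ha
    exact Module.finitePresentation_of_projective _ _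

/-- A finite étale algebra over an integrally closed domain is the integral closure of the base
ring in its generic fiber `A ⊗_R K`. -/
theorem finite_etale_isIntegralClosure
    (R : Type) [CommRing R] [IsDomain R] [IsIntegrallyClosed R]
    (A : Type) [CommRing A] [Algebra R A] [Module.Finite R A] [Module.Flat R A]
    [Algebra.FormallyUnramified R A] :
    IsIntegralClosure A R (A ⊗[R] (FractionRing R)) := by
  have : Module.FinitePresentation R A := .of_finite_of_flat_of_isDomain R A
  have : Algebra.FinitePresentation R A := inferInstance
  have : Algebra.Etale R A := .of_formallyUnramified_of_flat
  refine ⟨Algebra.TensorProduct.includeLeft_injective (S := R)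
    (IsFractionRing.injective R (FractionRing R)), fun {x} ↦ ⟨fun hx ↦ ?_, ?_⟩⟩
  · obtain ⟨z, hz⟩ :=
      (TensorProduct.toIntegralClosure_bijective_of_smooth
        (R := R) (S := A) (B := FractionRing R)).2 ⟨x, hx.tower_top⟩
    replace hz : Algebra.TensorProduct.map (.id A A) (integralClosure R (FractionRing R)).val z =
      x := congrArg Subtype.val hz
    rw [← hz, ← RingHom.mem_range]
    clear hz
    induction z with
    | zero => simp
    | add y z hy hz => rw [map_add]; exact add_mem hy hz
    | tmul a b =>
      obtain ⟨r, hr⟩ := IsIntegrallyClosed.isIntegral_iff.mp b.2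
      refine ⟨r • a, ?_⟩
      simp [← hr, Algebra.TensorProduct.algebraMap_apply, Algebra.algebraMap_eq_smul_one r,
        TensorProduct.smul_tmul']
  · rintro ⟨y, rfl⟩
    exact (Algebra.IsIntegral.isIntegral y).algebraMap
end
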